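/- Assume χ₁ ≠ ωχ₂ and that the central character of ρ = τ⊗σ is unitary, i.e. |χ₁(π)χ₂(π)π^{2m+n}| = 1. In the Kirillov model K, let F′₀(x) = χ₁(x)·1_{O_F}(x), F″₀(x) = ω(x)χ₂(x)·1_{O_F}(x), F′_k(x) = F′₀(π^{-k}x), F″_k(x) = F″₀(π^{-k}x), and Λ = Σ_{i=0}^{n} (O_E[B](u^i ⊗ F′₀) + O_E[B](u^i ⊗ F″₀)). Then every element of Λ can be written as a finite sum φ(x) = Σ_{k=k₀}^{∞} Σ_{β∈W} ( c′_k(β)ψ_β(−π^{-k}x)F′_k(x) + c″_k(β)ψ_β(−π^{-k}x)F″_k(x) ), where c′_k(β), c″_k(β) ∈ π^{-km}N_k(β) for all k and β. -/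

import Mathlib

open scoped Classical
open Matrix

noncomputable section

namespace BS

variable (E : Type) [Field E]

/-- The ring of integers of a subfield `F` of `E`, with respect to a nonarchimedean
absolute value on `E`, as an additive subgroup of `F`. -/
def OFadd (abs : AbsoluteValue E ℝ)
    (na : ∀ x y : E, abs (x + y) ≤ max (abs x) (abs y))
    (F : Subfield E) : AddSubgroup F where
  carrier := {x | abs (x : E) ≤ 1}
  zero_mem' := by simp
  add_mem' := by
    intro a b ha hb
    simp only [Set.mem_setOf_eq] at *
    have h : ((a + b : F) : E) = (a : E) + (b : E) := by push_cast; ring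
    rw [h]
    exact le_trans (na _ _) (max_le ha hb)
  neg_mem' := by
    intro a ha
    simp only [Set.mem_setOf_eq] at *
    have h : ((-a : F) : E) = -(a : E) := by push_cast; ring
    rw [h, abs.map_neg]
    exact ha

/-- `W = F/O_F`. -/
abbrev Wq (abs : AbsoluteValue E ℝ)
    (na : ∀ x y : E, abs (x + y) ≤ max (abs x) (abs y))
    (F : Subfield E) : Type := F ⧸ OFadd E abs na F

/-- The canonical projection `F → W = F/O_F`. -/
def mkW (abs : AbsoluteValue E ℝ)
    (na : ∀ x y : E, abs (x + y) ≤ max (abs x) (abs y))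
    (F : Subfield E) : F →+ Wq E abs na F := QuotientAddGroup.mk' _

/-- Multiplication by `π` on `W = F/O_F`. -/
def pmulW (abs : AbsoluteValue E ℝ)
    (na : ∀ x y : E, abs (x + y) ≤ max (abs x) (abs y))
    (F : Subfield E) (π : F) (hπ : abs (π : E) ≤ 1) :
    Wq E abs na F →+ Wq E abs na F :=
  QuotientAddGroup.map _ _ (AddMonoidHom.mulLeft π) (by
    intro x hx
    simp only [AddSubgroup.mem_comap, AddMonoidHom.coe_mulLeft]
    show abs ((π * x : F) : E) ≤ 1
    have h : ((π * x : F) : E) = (π : E) * (x : E) := by push_cast; ring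
    rw [h, abs.map_mul]
    have hx' : abs (x : E) ≤ 1 := hx
    nlinarith [abs.nonneg (x : E), abs.nonneg (π : E)])


/-- Extension of a character `χ : F^× → E^×` to `F`, by `0` at `0`. -/
def extChar (F : Subfield E) (χ : Fˣ →* Eˣ) (x : F) : E :=
  if h : x = 0 then 0 else (χ (Units.mk0 x h) : E)

/-- A matrix over the subfield `F`, viewed over `E`. -/
def matE (F : Subfield E) (g : Matrix (Fin 2) (Fin 2) F) : Matrix (Fin 2) (Fin 2) E :=
  fun i j => (g i j : E)

/-- The rational representation `τ = det(·)^m ⊗ Sym^n` on `V_τ = E[u]^{≤n}`, realized on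
polynomials: `τ([[a,b],[c,d]])·u^i = (ad−bc)^m (a+cu)^{n−i} (b+du)^i`. -/
def tauPoly (m : ℤ) (n : ℕ) (g : Matrix (Fin 2) (Fin 2) E) (P : Polynomial E) :
    Polynomial E :=
  ((g 0 0 * g 1 1 - g 0 1 * g 1 0) ^ m) •
    ∑ i ∈ Finset.range (n + 1), P.coeff i •
      ((Polynomial.C (g 0 0) + Polynomial.C (g 1 0) * Polynomial.X) ^ (n - i) *
       (Polynomial.C (g 0 1) + Polynomial.C (g 1 1) * Polynomial.X) ^ i)

/-- The `O_E`-span of the translates, by elements of the set `{g : G | P g}`, of elements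
of `S` — e.g. `O_E[B]·S`. -/
def OESpan (abs : AbsoluteValue E ℝ) {G V : Type} [AddCommMonoid V] [Module E V]
    (act : G → V → V) (P : G → Prop) (S : Set V) : Set V :=
  {x | ∃ (k : ℕ) (c : Fin k → E) (b : Fin k → G) (w : Fin k → V),
    (∀ i, abs (c i) ≤ 1) ∧ (∀ i, P (b i)) ∧ (∀ i, w i ∈ S) ∧
    x = ∑ i, c i • act (b i) (w i)}

/-- The action of an upper triangular matrix `g = [[a,b],[0,d]]` on the Kirillov model
`K` of `ρ = τ⊗σ`: `(ρ(g)φ)(x) = χ₁(d)χ₂(d)·τ(g)(ψ((b/d)x)·φ((a/d)x))`. -/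
def kirAct (F : Subfield E) (χ1 χ2 : Fˣ →* Eˣ) (ψ : F → E) (m : ℤ) (n : ℕ)
    (g : GL (Fin 2) F) (φ : F → Polynomial E) : F → Polynomial E :=
  fun x =>
    (extChar E F χ1 ((g : Matrix (Fin 2) (Fin 2) F) 1 1) *
      extChar E F χ2 ((g : Matrix (Fin 2) (Fin 2) F) 1 1)) •
      tauPoly E m n (matE E F (g : Matrix (Fin 2) (Fin 2) F))
        ((ψ ((((g : Matrix (Fin 2) (Fin 2) F) 0 1) /
              ((g : Matrix (Fin 2) (Fin 2) F) 1 1)) * x)) •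
          φ ((((g : Matrix (Fin 2) (Fin 2) F) 0 0) /
              ((g : Matrix (Fin 2) (Fin 2) F) 1 1)) * x))

/-- The function `F′₀ = 1_{O_F}·χ₁`. -/
def Fprime0 (abs : AbsoluteValue E ℝ) (F : Subfield E) (χ1 : Fˣ →* Eˣ) : F → E :=
  fun x => if abs (x : E) ≤ 1 then extChar E F χ1 x else 0

/-- The normalized valuation on `F` (the integer `k` with `|x| = |π|^k`). -/
def vall (abs : AbsoluteValue E ℝ) (F : Subfield E) (π : F) (x : F) : ℤ :=
  if h : ∃ k : ℤ, abs (x : E) = abs (π : E) ^ k then h.choose else 0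

/-- The unramified character `ω` of `F^×` with `ω(π) = q⁻¹` (extended by `0` at `0`). -/
def omegaFun (abs : AbsoluteValue E ℝ) (F : Subfield E) (π : F) (q : ℕ) (x : F) : E :=
  if x = 0 then 0 else (q : E) ^ (-(vall E abs F π x))

/-- The function `F″₀ = 1_{O_F}·ωχ₂`. -/
def Fsecond0 (abs : AbsoluteValue E ℝ) (F : Subfield E) (π : F) (q : ℕ)
    (χ2 : Fˣ →* Eˣ) : F → E :=
  fun x => if abs (x : E) ≤ 1 then omegaFun E abs F π q x * extChar E F χ2 x else 0

/-- The lattice `N_l(β) = {P ∈ E[u]^{≤n} : |P(u)| ≤ |π|^{-nl} for all u ∈ D_l(β)}`, where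
`D_l(β) = {u ∈ F : |u − π^{-l}b| ≤ |π^{-l}|}` for any lift `b ∈ F` of `β`. -/
def Nset (abs : AbsoluteValue E ℝ)
    (na : ∀ x y : E, abs (x + y) ≤ max (abs x) (abs y))
    (F : Subfield E) (π : F) (n : ℕ) (l : ℤ) (β : Wq E abs na F) : Set (Polynomial E) :=
  {P | P.degree ≤ (n : WithBot ℕ) ∧ ∀ b : F, mkW E abs na F b = β → ∀ u : F,
      abs ((u : E) - (π : E) ^ (-l) * (b : E)) ≤ abs ((π : E) ^ (-l)) →
      abs (Polynomial.eval (u : E) P) ≤ abs (π : E) ^ (-((n : ℤ) * l))}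

section Helpers

variable {E}
variable {abs : AbsoluteValue E ℝ} {na : ∀ x y : E, abs (x + y) ≤ max (abs x) (abs y)}
  {F : Subfield E} {π : F}

/-- Membership in `π^{-km} N_k(β)`. -/
def MemScaledN (abs : AbsoluteValue E ℝ)
    (na : ∀ x y : E, abs (x + y) ≤ max (abs x) (abs y))
    (F : Subfield E) (π : F) (m : ℤ) (n : ℕ) (k : ℤ) (β : Wq E abs na F)
    (P : Polynomial E) : Prop :=
  ∃ Q ∈ Nset E abs na F π n k β, P = ((π : E) ^ (-(k * m))) • Q

theorem memScaledN_zero (m : ℤ) (n : ℕ) (k : ℤ) (β : Wq E abs na F) :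
    MemScaledN abs na F π m n k β 0 := by
  refine ⟨0, ⟨by simp, fun b _ u _ => ?_⟩, by simp⟩
  simp only [Polynomial.eval_zero, map_zero]
  exact zpow_nonneg (abs.nonneg _) _

theorem MemScaledN.add {m : ℤ} {n : ℕ} {k : ℤ} {β : Wq E abs na F} {P Q : Polynomial E}
    (hP : MemScaledN abs na F π m n k β P) (hQ : MemScaledN abs na F π m n k β Q) :
    MemScaledN abs na F π m n k β (P + Q) := by
  obtain ⟨P, ⟨hPd, hP⟩, rfl⟩ := hP
  obtain ⟨Q, ⟨hQd, hQ⟩, rfl⟩ := hQ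
  refine ⟨P + Q, ⟨(Polynomial.degree_add_le _ _).trans (max_le hPd hQd),
    fun b hb u hu => ?_⟩, (smul_add _ _ _).symm⟩
  rw [Polynomial.eval_add]
  exact (na _ _).trans (max_le (hP b hb u hu) (hQ b hb u hu))

theorem MemScaledN.smul {m : ℤ} {n : ℕ} {k : ℤ} {β : Wq E abs na F} {P : Polynomial E}
    {c : E} (hc : abs c ≤ 1) (hP : MemScaledN abs na F π m n k β P) :
    MemScaledN abs na F π m n k β (c • P) := by
  obtain ⟨P, ⟨hPd, hP⟩, rfl⟩ := hP
  refine ⟨c • P, ⟨(Polynomial.degree_smul_le _ _).trans hPd, fun b hb u hu => ?_⟩,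
    smul_comm _ _ _⟩
  rw [Polynomial.eval_smul, smul_eq_mul, map_mul]
  exact (mul_le_of_le_one_left (abs.nonneg _) hc).trans (hP b hb u hu)

/-- The functions `ψ_β(−π^{-k}x) f(π^{-k}x)` on `F`. -/
def twist (na : ∀ x y : E, abs (x + y) ≤ max (abs x) (abs y)) (π : F) (ψ f : F → E)
    (p : ℤ × Wq E abs na F) (x : F) : E :=
  ψ (-(π ^ (-p.1) * Quotient.out p.2 * x)) * f (π ^ (-p.1) * x)

/-- `φ` is a finite combination of the functions `twist f` and `twist g`, with coefficients
in the lattices `π^{-km} N_k(β)`. -/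
def HasExpansion (abs : AbsoluteValue E ℝ)
    (na : ∀ x y : E, abs (x + y) ≤ max (abs x) (abs y))
    (F : Subfield E) (π : F) (ψ f g : F → E) (m : ℤ) (n : ℕ) (φ : F → Polynomial E) : Prop :=
  ∃ C : (ℤ × Wq E abs na F) →₀ (Polynomial E × Polynomial E),
    (∀ p, MemScaledN abs na F π m n p.1 p.2 (C p).1) ∧
    (∀ p, MemScaledN abs na F π m n p.1 p.2 (C p).2) ∧
    ∀ x : F, x ≠ 0 →
      φ x = C.sum fun p P => twist na π ψ f p x • P.1 + twist na π ψ g p x • P.2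

variable {ψ f g : F → E} {m : ℤ} {n : ℕ}

theorem hasExpansion_zero : HasExpansion abs na F π ψ f g m n 0 :=
  ⟨0, fun _ => memScaledN_zero _ _ _ _, fun _ => memScaledN_zero _ _ _ _, by simp⟩

theorem HasExpansion.add {φ₁ φ₂ : F → Polynomial E}
    (h₁ : HasExpansion abs na F π ψ f g m n φ₁) (h₂ : HasExpansion abs na F π ψ f g m n φ₂) :
    HasExpansion abs na F π ψ f g m n (φ₁ + φ₂) := by
  obtain ⟨C, hC1, hC2, hC⟩ := h₁
  obtain ⟨D, hD1, hD2, hD⟩ := h₂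
  refine ⟨C + D, fun p => (hC1 p).add (hD1 p), fun p => (hC2 p).add (hD2 p), fun x hx => ?_⟩
  rw [Finsupp.sum_add_index', Pi.add_apply, hC x hx, hD x hx]
  · simp
  · intro p P Q
    simp only [Prod.fst_add, Prod.snd_add, smul_add]
    abel

theorem HasExpansion.smul {φ : F → Polynomial E} {c : E} (hc : abs c ≤ 1)
    (h : HasExpansion abs na F π ψ f g m n φ) :
    HasExpansion abs na F π ψ f g m n (c • φ) := by
  obtain ⟨C, hC1, hC2, hC⟩ := h
  refine ⟨c • C, fun p => (hC1 p).smul hc, fun p => (hC2 p).smul hc, fun x hx => ?_⟩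
  rw [Finsupp.sum_smul_index' (by simp), Pi.smul_apply, hC x hx, Finsupp.smul_sum]
  simp only [Prod.smul_fst, Prod.smul_snd, smul_add, smul_comm c]

theorem HasExpansion.sum {ι : Type*} (s : Finset ι) {φ : ι → F → Polynomial E}
    (h : ∀ i ∈ s, HasExpansion abs na F π ψ f g m n (φ i)) :
    HasExpansion abs na F π ψ f g m n (∑ i ∈ s, φ i) :=
  Finset.sum_induction _ _ (fun _ _ => HasExpansion.add) hasExpansion_zero h

theorem hasExpansion_of_left {φ : F → Polynomial E} {p : ℤ × Wq E abs na F}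
    {P : Polynomial E} (hP : MemScaledN abs na F π m n p.1 p.2 P)
    (h : ∀ x, φ x = twist na π ψ f p x • P) : HasExpansion abs na F π ψ f g m n φ := by
  refine ⟨Finsupp.single p (P, 0), fun r => ?_, fun r => ?_, fun x _ => ?_⟩
  · by_cases hr : p = r
    · subst hr; simpa using hP
    · simpa [Finsupp.single_apply, hr] using memScaledN_zero m n r.1 r.2
  · by_cases hr : p = r
    · subst hr; simpa using memScaledN_zero m n p.1 p.2
    · simpa [Finsupp.single_apply, hr] using memScaledN_zero m n r.1 r.2
  · rw [Finsupp.sum_single_index (by simp), h x]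
    simp

theorem HasExpansion.swap {φ : F → Polynomial E} (h : HasExpansion abs na F π ψ f g m n φ) :
    HasExpansion abs na F π ψ g f m n φ := by
  obtain ⟨C, hC1, hC2, hC⟩ := h
  refine ⟨C.mapRange Prod.swap rfl, fun p => by simpa using hC2 p,
    fun p => by simpa using hC1 p, fun x hx => ?_⟩
  rw [hC x hx, Finsupp.sum_mapRange_index (by simp)]
  simp [add_comm]

/-- The set of `w ∈ W` killed by `π^N` is finite if multiplication by `π` on `W` has
finite fibres. -/
theorem finite_torsion (hπ1 : abs (π : E) ≤ 1)
    (hfin : ∀ γ : Wq E abs na F, Finite {β : Wq E abs na F // pmulW E abs na F π hπ1 β = γ})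
    (N : ℕ) : {w : Wq E abs na F | (pmulW E abs na F π hπ1)^[N] w = 0}.Finite := by
  induction N with
  | zero => simp
  | succ N ih =>
    have : {w : Wq E abs na F | (pmulW E abs na F π hπ1)^[N + 1] w = 0} =
        pmulW E abs na F π hπ1 ⁻¹' {w | (pmulW E abs na F π hπ1)^[N] w = 0} := by
      ext w; simp [Function.iterate_succ_apply]
    rw [this]
    exact ih.preimage' fun γ _ => Set.finite_coe_iff.1 (hfin γ)

theorem mkW_eq_iff (x y : F) : mkW E abs na F x = mkW E abs na F y ↔ abs ((x : E) - y) ≤ 1 := by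
  have h : mkW E abs na F x = mkW E abs na F y ↔ x - y ∈ OFadd E abs na F := by
    rw [← sub_eq_zero, ← map_sub]
    exact QuotientAddGroup.eq_zero_iff _
  rw [h]
  change abs ((x - y : F) : E) ≤ 1 ↔ _
  rw [Subfield.coe_sub]

theorem iterate_pmulW_mkW (hπ1 : abs (π : E) ≤ 1) (N : ℕ) (x : F) :
    (pmulW E abs na F π hπ1)^[N] (mkW E abs na F x) = mkW E abs na F (π ^ N * x) := by
  induction N generalizing x with
  | zero => simp
  | succ N ih =>
    have h : pmulW E abs na F π hπ1 (mkW E abs na F x) = mkW E abs na F (π * x) := rfl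
    rw [Function.iterate_succ_apply, h, ih, pow_succ, mul_assoc]

/-- Some positive power of a unit is congruent to `1` modulo `π^N`. -/
theorem exists_pow_sub_one_le (hπ0 : π ≠ 0) (hπ1 : abs (π : E) ≤ 1)
    (hfin : ∀ γ : Wq E abs na F, Finite {β : Wq E abs na F // pmulW E abs na F π hπ1 β = γ})
    (N : ℕ) (ε : F) (hε : abs (ε : E) = 1) :
    ∃ j : ℕ, j ≠ 0 ∧ abs ((ε : E) ^ j - 1) ≤ abs (π : E) ^ N := by
  have hπE : (π : E) ≠ 0 := by simpa using hπ0
  have hpos : 0 < abs (π : E) := abs.pos hπE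
  obtain ⟨i, -, j, -, hij, h⟩ := Set.infinite_univ.exists_lt_map_eq_of_mapsTo
    (f := fun i : ℕ => mkW E abs na F (ε ^ i / π ^ N)) (fun i _ => by
      simp only [Set.mem_ofPred_eq, iterate_pmulW_mkW]
      rw [mul_div_cancel₀ _ (pow_ne_zero N hπ0), ← map_zero (mkW E abs na F), mkW_eq_iff]
      simp [hε]) (finite_torsion hπ1 hfin N)
  refine ⟨j - i, by omega, ?_⟩
  rw [eq_comm, mkW_eq_iff] at h
  push_cast at h
  rw [← sub_div, map_div₀, map_pow, div_le_one (by positivity)] at h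
  have : (ε : E) ^ j - (ε : E) ^ i = (ε : E) ^ i * ((ε : E) ^ (j - i) - 1) := by
    rw [mul_sub, ← pow_add, Nat.add_sub_cancel' hij.le, mul_one]
  rwa [this, map_mul, map_pow, hε, one_pow, one_mul] at h

/-- A smooth character has absolute value `1` on units. -/
theorem abs_char_eq_one (hπ0 : π ≠ 0) (hπ1 : abs (π : E) ≤ 1)
    (hfin : ∀ γ : Wq E abs na F, Finite {β : Wq E abs na F // pmulW E abs na F π hπ1 β = γ})
    {χ : Fˣ →* Eˣ}
    (hsm : ∃ N : ℕ, ∀ u : Fˣ, abs (((u : F) : E) - 1) ≤ abs (π : E) ^ N → χ u = 1)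
    (ε : Fˣ) (hε : abs ((ε : F) : E) = 1) : abs (χ ε : E) = 1 := by
  obtain ⟨N, hN⟩ := hsm
  obtain ⟨j, hj, h⟩ := exists_pow_sub_one_le hπ0 hπ1 hfin N ε hε
  have h1 : χ (ε ^ j) = 1 := hN _ (by simpa using h)
  rw [map_pow] at h1
  have h2 : abs (χ ε : E) ^ j = 1 := by
    rw [← map_pow, ← Units.val_pow_eq_pow_val, h1]
    simp
  exact (pow_eq_one_iff_of_nonneg (abs.nonneg _) hj).1 h2

theorem extChar_of_ne_zero (χ : Fˣ →* Eˣ) {x : F} (hx : x ≠ 0) :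
    extChar E F χ x = (χ (Units.mk0 x hx) : E) := dif_neg hx

theorem extChar_mul (χ : Fˣ →* Eˣ) (x y : F) :
    extChar E F χ (x * y) = extChar E F χ x * extChar E F χ y := by
  by_cases hx : x = 0
  · simp [extChar, hx]
  by_cases hy : y = 0
  · simp [extChar, hy]
  rw [extChar_of_ne_zero χ hx, extChar_of_ne_zero χ hy, extChar_of_ne_zero χ (mul_ne_zero hx hy),
    Units.mk0_mul, map_mul, Units.val_mul]

theorem extChar_zpow (χ : Fˣ →* Eˣ) {x : F} (hx : x ≠ 0) (k : ℤ) :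
    extChar E F χ (x ^ k) = extChar E F χ x ^ k := by
  rw [extChar_of_ne_zero χ hx, extChar_of_ne_zero χ (zpow_ne_zero k hx),
    ← Units.val_zpow_eq_zpow_val, ← map_zpow]
  congr 2
  ext
  simp

theorem abs_unit_mul {ε : F} (hε : abs (ε : E) = 1) (y : F) :
    abs ((ε * y : F) : E) = abs (y : E) := by
  rw [Subfield.coe_mul, map_mul, hε, one_mul]

theorem Fprime0_unit_mul (χ : Fˣ →* Eˣ) {ε : F} (hε : abs (ε : E) = 1) (y : F) :
    Fprime0 E abs F χ (ε * y) = extChar E F χ ε * Fprime0 E abs F χ y := by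
  simp only [Fprime0, abs_unit_mul hε, extChar_mul, mul_ite, mul_zero]

theorem omegaFun_unit_mul (q : ℕ) {ε : F} (hε : abs (ε : E) = 1) (y : F) :
    omegaFun E abs F π q (ε * y) = omegaFun E abs F π q y := by
  have hε0 : ε ≠ 0 := by rintro rfl; simp at hε
  simp only [omegaFun, vall, abs_unit_mul hε, mul_eq_zero, hε0, false_or]

theorem Fsecond0_unit_mul (q : ℕ) (χ : Fˣ →* Eˣ) {ε : F} (hε : abs (ε : E) = 1) (y : F) :
    Fsecond0 E abs F π q χ (ε * y) = extChar E F χ ε * Fsecond0 E abs F π q χ y := by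
  simp only [Fsecond0, abs_unit_mul hε, extChar_mul, omegaFun_unit_mul q hε, mul_ite, mul_zero,
    mul_left_comm]

theorem subfield_coe_zpow (x : F) (k : ℤ) : ((x ^ k : F) : E) = (x : E) ^ k :=
  map_zpow₀ F.subtype x k

theorem exists_unit_mul_zpow (hπ0 : π ≠ 0) {x : F} {k : ℤ}
    (hk : abs (x : E) = abs (π : E) ^ k) :
    ∃ ε : F, abs (ε : E) = 1 ∧ x = ε * π ^ k := by
  have hπE : (π : E) ≠ 0 := by simpa using hπ0
  refine ⟨x / π ^ k, ?_, (div_mul_cancel₀ _ (zpow_ne_zero k hπ0)).symm⟩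
  rw [Subfield.coe_div, subfield_coe_zpow, map_div₀, map_zpow₀, hk,
    div_self (zpow_ne_zero k (abs.ne_zero hπE))]

/-- The central character is unitary on all of `F^×`. -/
theorem abs_central (hπ0 : π ≠ 0)
    (hdisc : ∀ x : F, x ≠ 0 → ∃ k : ℤ, abs (x : E) = abs (π : E) ^ k)
    {χ1 χ2 : Fˣ →* Eˣ}
    (h1 : ∀ ε : F, abs (ε : E) = 1 → abs (extChar E F χ1 ε) = 1)
    (h2 : ∀ ε : F, abs (ε : E) = 1 → abs (extChar E F χ2 ε) = 1) {l : ℤ}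
    (hcentral : abs (extChar E F χ1 π * extChar E F χ2 π * (π : E) ^ l) = 1)
    {d : F} (hd : d ≠ 0) :
    abs (extChar E F χ1 d * extChar E F χ2 d) * abs (d : E) ^ l = 1 := by
  obtain ⟨k, hk⟩ := hdisc d hd
  obtain ⟨ε, hε, rfl⟩ := exists_unit_mul_zpow hπ0 hk
  rw [map_mul, map_mul, map_zpow₀] at hcentral
  rw [hk]
  simp only [extChar_mul, extChar_zpow _ hπ0, map_mul, map_zpow₀, h1 ε hε, h2 ε hε, one_mul]
  rw [zpow_comm, ← mul_zpow, ← mul_zpow, hcentral, _root_.one_zpow]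

theorem tauPoly_X_pow {g : Matrix (Fin 2) (Fin 2) E} (hg : g 1 0 = 0) (m : ℤ) {n i : ℕ}
    (hi : i ≤ n) (c : E) :
    tauPoly E m n g (c • Polynomial.X ^ i) =
      c • (((g 0 0 * g 1 1) ^ m * g 0 0 ^ (n - i)) •
        (Polynomial.C (g 0 1) + Polynomial.C (g 1 1) * Polynomial.X) ^ i) := by
  unfold tauPoly
  rw [Finset.sum_eq_single i]
  · simp only [hg, Polynomial.coeff_smul, Polynomial.coeff_X_pow, if_true, mul_zero, sub_zero,
      map_zero, zero_mul, add_zero, smul_eq_mul, mul_one, ← Polynomial.C_pow,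
      ← Polynomial.smul_eq_C_mul, smul_smul]
    congr 1
    ring
  · intro j _ hj
    simp [Polynomial.coeff_X_pow, hj]
  · intro h
    simp at h
    omega

/-- The translate of `u^i ⊗ f` by an upper triangular matrix is a single term of an
expansion. -/
theorem exists_kirAct_eq_twist (hπ0 : π ≠ 0)
    (hdisc : ∀ x : F, x ≠ 0 → ∃ k : ℤ, abs (x : E) = abs (π : E) ^ k)
    (hψadd : ∀ x y : F, ψ (x + y) = ψ x * ψ y)
    (hψO : ∀ x : F, abs (x : E) ≤ 1 → ψ x = 1)
    {χ1 χ2 χ : Fˣ →* Eˣ}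
    (hχ : ∀ ε : F, abs (ε : E) = 1 → abs (extChar E F χ ε) = 1)
    (hcen : ∀ d : F, d ≠ 0 → abs (extChar E F χ1 d * extChar E F χ2 d) *
      abs (d : E) ^ (2 * m + (n : ℤ)) = 1)
    (hf0 : ∀ y : F, ¬ abs (y : E) ≤ 1 → f y = 0)
    (hf : ∀ ε : F, abs (ε : E) = 1 → ∀ y, f (ε * y) = extChar E F χ ε * f y)
    {b : GL (Fin 2) F} (hb : (b : Matrix (Fin 2) (Fin 2) F) 1 0 = 0) {i : ℕ} (hi : i ≤ n) :
    ∃ (p : ℤ × Wq E abs na F) (P : Polynomial E), MemScaledN abs na F π m n p.1 p.2 P ∧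
      ∀ x, kirAct E F χ1 χ2 ψ m n b (fun x => f x • Polynomial.X ^ i) x =
        twist na π ψ f p x • P := by
  have hdet : (b : Matrix (Fin 2) (Fin 2) F).det ≠ 0 := b.det.ne_zero
  rw [Matrix.det_fin_two, hb, mul_zero, sub_zero] at hdet
  set a := (b : Matrix (Fin 2) (Fin 2) F) 0 0 with ha
  set t := (b : Matrix (Fin 2) (Fin 2) F) 0 1 with ht
  set d := (b : Matrix (Fin 2) (Fin 2) F) 1 1 with hd
  have ha0 : a ≠ 0 := left_ne_zero_of_mul hdet
  have hd0 : d ≠ 0 := right_ne_zero_of_mul hdet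
  have haE : (a : E) ≠ 0 := by simpa using ha0
  have hdE : (d : E) ≠ 0 := by simpa using hd0
  have hπE : (π : E) ≠ 0 := by simpa using hπ0
  obtain ⟨k, hk⟩ : ∃ k : ℤ, abs ((a / d : F) : E) = abs (π : E) ^ (-k) := by
    obtain ⟨k, hk⟩ := hdisc (a / d) (div_ne_zero ha0 hd0)
    exact ⟨-k, by rw [hk, neg_neg]⟩
  obtain ⟨ε, hε, hεk⟩ := exists_unit_mul_zpow hπ0 hk
  have hkE : abs (a : E) = abs (d : E) * abs (π : E) ^ (-k) := by
    rw [← hk]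
    push_cast
    rw [map_div₀, mul_div_cancel₀ _ (abs.ne_zero hdE)]
  set s : F := -(π ^ k * (t / d)) with hs
  set P : Polynomial E := (extChar E F χ1 d * extChar E F χ2 d * extChar E F χ ε *
      (((a : E) * d) ^ m * (a : E) ^ (n - i))) •
    (Polynomial.C (t : E) + Polynomial.C (d : E) * Polynomial.X) ^ i with hP
  refine ⟨(k, mkW E abs na F s), P, ?_, fun x => ?_⟩
  · refine ⟨((π : E) ^ (k * m)) • P, ⟨?_, fun b' hb' u hu => ?_⟩, ?_⟩
    · rw [hP, smul_smul]
      refine (Polynomial.degree_smul_le _ _).trans ?_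
      refine Polynomial.degree_le_of_natDegree_le ?_
      refine Polynomial.natDegree_pow_le_of_le i (m := 1) ?_ |>.trans (by simpa using hi)
      compute_degree
    · rw [mkW_eq_iff] at hb'
      have hu' : abs ((t : E) + d * u) ≤ abs (a : E) := by
        have h1 : (t : E) + d * u =
            d * ((u - (π : E) ^ (-k) * b') + (π : E) ^ (-k) * (b' - s)) := by
          rw [hs]
          push_cast [subfield_coe_zpow]
          rw [_root_.zpow_neg]
          field_simp
          ring
        rw [h1, map_mul, hkE]
        refine mul_le_mul_of_nonneg_left ((na _ _).trans (max_le ?_ ?_)) (abs.nonneg _)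
        · rwa [map_zpow₀] at hu
        · rw [map_mul, map_zpow₀]
          exact mul_le_of_le_one_right (zpow_nonneg (abs.nonneg _) _) hb'
      have hD : abs (d : E) ≠ 0 := abs.ne_zero hdE
      have hϖ : abs (π : E) ≠ 0 := abs.ne_zero hπE
      have hc := hcen d hd0
      have hc' : abs (extChar E F χ1 d * extChar E F χ2 d) =
          abs (d : E) ^ (-(2 * m + (n : ℤ))) := by
        rw [_root_.zpow_neg]
        exact eq_inv_of_mul_eq_one_left hc
      simp only [hP, Polynomial.eval_smul, Polynomial.eval_pow, Polynomial.eval_add,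
        Polynomial.eval_mul, Polynomial.eval_C, Polynomial.eval_X, smul_eq_mul]
      rw [map_mul, map_mul, map_mul, map_mul _ _ (extChar E F χ ε), hc', hχ ε hε, mul_one]
      simp only [map_mul, map_pow, map_zpow₀]
      calc abs (π : E) ^ (k * m) * (abs (d : E) ^ (-(2 * m + (n : ℤ))) *
            ((abs (a : E) * abs (d : E)) ^ m * abs (a : E) ^ (n - i)) *
            abs ((t : E) + d * u) ^ i)
          ≤ abs (π : E) ^ (k * m) * (abs (d : E) ^ (-(2 * m + (n : ℤ))) *
            ((abs (a : E) * abs (d : E)) ^ m * abs (a : E) ^ (n - i)) *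
            abs (a : E) ^ i) := by gcongr
        _ = abs (π : E) ^ (k * m) * (abs (d : E) ^ (-(2 * m + (n : ℤ))) *
            ((abs (a : E) * abs (d : E)) ^ m * abs (a : E) ^ (n : ℤ))) := by
          rw [zpow_natCast, ← pow_sub_mul_pow (abs (a : E)) hi]
          ring
        _ = abs (π : E) ^ (-((n : ℤ) * k)) := by
          rw [hkE]
          simp only [mul_zpow, ← _root_.zpow_mul]
          have e1 : abs (d : E) ^ (-(2 * m + (n : ℤ))) * abs (d : E) ^ m * abs (d : E) ^ m *
              abs (d : E) ^ (n : ℤ) = 1 := by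
            rw [← zpow_add₀ hD, ← zpow_add₀ hD, ← zpow_add₀ hD]
            ring_nf
            simp
          have e2 : abs (π : E) ^ (k * m) * abs (π : E) ^ (-k * m) *
              abs (π : E) ^ (-k * (n : ℤ)) = abs (π : E) ^ (-((n : ℤ) * k)) := by
            rw [← zpow_add₀ hϖ, ← zpow_add₀ hϖ]
            ring_nf
          rw [← e2, ← mul_one (abs (π : E) ^ (k * m) * _ * _), ← e1]
          ring
    · rw [smul_smul, ← zpow_add₀ hπE, neg_add_cancel, zpow_zero, one_smul]
  · have hg : matE E F (b : Matrix (Fin 2) (Fin 2) F) 1 0 = 0 := by simp [matE, hb]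
    unfold kirAct
    simp only [smul_smul]
    rw [tauPoly_X_pow hg m hi]
    simp only [matE, ← ha, ← ht, ← hd, twist, hP, smul_smul]
    congr 1
    rw [hεk, mul_assoc ε, hf ε hε]
    by_cases hx : abs ((π ^ (-k) * x : F) : E) ≤ 1
    · have hψ : ψ (t / d * x) =
          ψ (-(π ^ (-k) * Quotient.out (mkW E abs na F s) * x)) := by
        set o : F := Quotient.out (mkW E abs na F s) with ho
        have hos : abs ((o : E) - s) ≤ 1 := by
          rw [← mkW_eq_iff (na := na)]
          exact Quotient.out_eq (mkW E abs na F s)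
        have h1 : t / d * x = -(π ^ (-k) * o * x) + (o - s) * (π ^ (-k) * x) := by
          rw [hs, _root_.zpow_neg]
          field_simp
          ring
        rw [h1, hψadd, hψO ((o - s) * (π ^ (-k) * x)), mul_one]
        rw [Subfield.coe_mul, map_mul, Subfield.coe_sub]
        exact mul_le_one₀ hos (abs.nonneg _) hx
      rw [hψ]
      ring
    · rw [hf0 _ hx]
      ring

end Helpers

/-- Lemma 2.5 of the paper: assume `χ₁ ≠ ωχ₂` and that the central character
of `ρ = τ⊗σ` is unitary.  Then every element of
`Λ = Σ_{i=0}^{n} (O_E[B](u^i ⊗ F′₀) + O_E[B](u^i ⊗ F″₀))` can be written as a finite sum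
`φ(x) = Σ_{k,β} (c′_k(β)ψ_β(−π^{-k}x)F′_k(x) + c″_k(β)ψ_β(−π^{-k}x)F″_k(x))` with
`c′_k(β), c″_k(β) ∈ π^{-km}N_k(β)`. -/
theorem stmt12 [CharZero E] [IsAlgClosed E]
    (abs : AbsoluteValue E ℝ)
    (na : ∀ x y : E, abs (x + y) ≤ max (abs x) (abs y))
    (F : Subfield E) (π : F)
    (hπ0 : π ≠ 0) (hπ1 : abs (π : E) < 1)
    (hdisc : ∀ x : F, x ≠ 0 → ∃ k : ℤ, abs (x : E) = abs (π : E) ^ k)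
    -- the residue field of `F` has `q` elements
    (q : ℕ) (hq : 0 < q)
    (hcard : ∀ γ : Wq E abs na F,
      Nat.card {β : Wq E abs na F // pmulW E abs na F π hπ1.le β = γ} = q)
    -- `ψ` is an additive character of `F`, trivial on `O_F`, under which `O_F` is its own
    -- annihilator:
    (ψ : F → E)
    (hψadd : ∀ x y : F, ψ (x + y) = ψ x * ψ y)
    (hψO : ∀ x : F, abs (x : E) ≤ 1 → ψ x = 1)
    (hψann : ∀ b : F, 1 < abs (b : E) → ∃ x : F, abs (x : E) ≤ 1 ∧ ψ (b * x) ≠ 1)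
    -- smooth characters `χ₁, χ₂` of `F^×`:
    (χ1 χ2 : Fˣ →* Eˣ)
    (hsm1 : ∃ N : ℕ, ∀ u : Fˣ, abs (((u : F) : E) - 1) ≤ abs (π : E) ^ N → χ1 u = 1)
    (hsm2 : ∃ N : ℕ, ∀ u : Fˣ, abs (((u : F) : E) - 1) ≤ abs (π : E) ^ N → χ2 u = 1)
    (m : ℤ) (n : ℕ)
    -- `χ₁ ≠ ωχ₂`:
    (hneq : ¬ ((∀ u : Fˣ, abs ((u : F) : E) = 1 → χ1 u = χ2 u) ∧
      (q : E) * (χ1 (Units.mk0 π hπ0) : E) = (χ2 (Units.mk0 π hπ0) : E)))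
    -- the central character of `ρ` is unitary: `|χ₁(π)χ₂(π)π^{2m+n}| = 1`:
    (hcentral : abs ((χ1 (Units.mk0 π hπ0) : E) * (χ2 (Units.mk0 π hπ0) : E) *
      (π : E) ^ (2 * m + (n : ℤ))) = 1) :
    ∀ φ : F → Polynomial E,
      -- `φ ∈ Λ = Σ_{i=0}^{n} (O_E[B](u^i ⊗ F′₀) + O_E[B](u^i ⊗ F″₀))`:
      φ ∈ OESpan E abs (kirAct E F χ1 χ2 ψ m n)
          (fun b => (b : Matrix (Fin 2) (Fin 2) F) 1 0 = 0)
          {φ0 | ∃ i : Fin (n+1),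
            φ0 = (fun x : F => Fprime0 E abs F χ1 x •
                    (Polynomial.X ^ (i : ℕ) : Polynomial E)) ∨
            φ0 = (fun x : F => Fsecond0 E abs F π q χ2 x •
                    (Polynomial.X ^ (i : ℕ) : Polynomial E))} →
      ∃ c' c'' : ℤ → Wq E abs na F → Polynomial E,
        -- the sum below is finite:
        {p : ℤ × Wq E abs na F | c' p.1 p.2 ≠ 0 ∨ c'' p.1 p.2 ≠ 0}.Finite ∧
        -- `c′_k(β), c″_k(β) ∈ π^{-km}N_k(β)`:
        (∀ (k : ℤ) (β : Wq E abs na F), ∃ P ∈ Nset E abs na F π n k β,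
          c' k β = ((π : E) ^ (-(k * m))) • P) ∧
        (∀ (k : ℤ) (β : Wq E abs na F), ∃ P ∈ Nset E abs na F π n k β,
          c'' k β = ((π : E) ^ (-(k * m))) • P) ∧
        -- `φ(x) = Σ_{k,β} c′_k(β)ψ_β(−π^{-k}x)F′_k(x) + c″_k(β)ψ_β(−π^{-k}x)F″_k(x)`,
        -- where `F′_k(x) = F′₀(π^{-k}x)` and `F″_k(x) = F″₀(π^{-k}x)`:
        (∀ x : F, x ≠ 0 →
          φ x = ∑ᶠ k : ℤ, ∑ᶠ β : Wq E abs na F,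
            ((ψ (-(π ^ (-k) * Quotient.out β * x)) *
                Fprime0 E abs F χ1 (π ^ (-k) * x)) • c' k β +
             (ψ (-(π ^ (-k) * Quotient.out β * x)) *
                Fsecond0 E abs F π q χ2 (π ^ (-k) * x)) • c'' k β)) := by
  rintro φ ⟨r, c, b, w, hc, hb, hw, rfl⟩
  have hfin : ∀ γ : Wq E abs na F,
      Finite {β : Wq E abs na F // pmulW E abs na F π hπ1.le β = γ} := fun γ =>
    Nat.finite_of_card_ne_zero (by rw [hcard γ]; exact hq.ne')
  have hunit : ∀ χ : Fˣ →* Eˣ,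
      (∃ N : ℕ, ∀ u : Fˣ, abs (((u : F) : E) - 1) ≤ abs (π : E) ^ N → χ u = 1) →
      ∀ ε : F, abs (ε : E) = 1 → abs (extChar E F χ ε) = 1 := by
    intro χ hsm ε hε
    have hε0 : ε ≠ 0 := by rintro rfl; simp at hε
    rw [extChar_of_ne_zero χ hε0]
    exact abs_char_eq_one hπ0 hπ1.le hfin hsm _ hε
  rw [← extChar_of_ne_zero χ1 hπ0, ← extChar_of_ne_zero χ2 hπ0] at hcentral
  have hcen := fun d (hd : d ≠ 0) =>
    abs_central hπ0 hdisc (hunit χ1 hsm1) (hunit χ2 hsm2) hcentral hd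
  have key : HasExpansion abs na F π ψ (Fprime0 E abs F χ1) (Fsecond0 E abs F π q χ2) m n
      (∑ j, c j • kirAct E F χ1 χ2 ψ m n (b j) (w j)) := by
    refine HasExpansion.sum _ fun j _ => HasExpansion.smul (hc j) ?_
    obtain ⟨i, hi | hi⟩ := hw j
    · obtain ⟨p, P, hP, h⟩ := exists_kirAct_eq_twist (na := na) hπ0 hdisc hψadd hψO
        (hunit χ1 hsm1) hcen (f := Fprime0 E abs F χ1) (fun y hy => if_neg hy)
        (fun ε hε y => Fprime0_unit_mul χ1 hε y) (hb j) (Nat.lt_succ_iff.1 i.2)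
      rw [hi]
      exact hasExpansion_of_left hP h
    · obtain ⟨p, P, hP, h⟩ := exists_kirAct_eq_twist (na := na) hπ0 hdisc hψadd hψO
        (hunit χ2 hsm2) hcen (f := Fsecond0 E abs F π q χ2) (fun y hy => if_neg hy)
        (fun ε hε y => Fsecond0_unit_mul q χ2 hε y) (hb j) (Nat.lt_succ_iff.1 i.2)
      rw [hi]
      exact (hasExpansion_of_left hP h).swap
  obtain ⟨C, hC1, hC2, hC⟩ := key
  have hsupp : ∀ p, (C p).1 ≠ 0 ∨ (C p).2 ≠ 0 → p ∈ C.support := by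
    intro p hp
    rw [Finsupp.mem_support_iff]
    rintro h
    simp [h] at hp
  refine ⟨fun k β => (C (k, β)).1, fun k β => (C (k, β)).2,
    C.support.finite_toSet.subset fun p hp => hsupp p hp,
    fun k β => hC1 (k, β), fun k β => hC2 (k, β), fun x hx => ?_⟩
  have hsub : (Function.support fun p => twist na π ψ (Fprime0 E abs F χ1) p x • (C p).1 +
      twist na π ψ (Fsecond0 E abs F π q χ2) p x • (C p).2) ⊆ C.support := by
    intro p hp
    refine hsupp p ?_
    by_contra! h
    exact hp (by simp [h.1, h.2])
  rw [hC x hx, Finsupp.sum, ← finsum_eq_sum_of_support_subset _ hsub,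
    finsum_curry _ (C.support.finite_toSet.subset hsub)]
  rfl


end BS
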